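/- There exist a knowledge graph G=(V,E,R,c,η) with pairwise coloring η and pairs of nodes (u,v) and (u',v') such that rwl_2^{(t)}(G,u,v) = rwl_2^{(t)}(G,u',v') for all t ≥ 0 but rwl_2⁺^{(1)}(G,u,v) ≠ rwl_2⁺^{(1)}(G,u',v'). (Concretely, one may take V = {u, u', v, v', x, x'}, R = {r₁, r₂}, E = {r₁(u,x), r₂(u',x')}, and η with η(u,v) = η(u',v'), comparing the pairs (u,v) and (u',v').) -/

import Mathlib

/-- A knowledge graph: a finite set of facts `r(u,v)` (stored as triples `(r,u,v)`)
together with a node coloring. -/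
structure KG (V R D : Type) where
  edges : Finset (R × V × V)
  color : V → D

namespace KG

variable {V R D D₂ X : Type}

/-- For a fact `r(u,v)` we say `u ∈ N_r(v)`.  `G.msgMS g v` is the multiset
`{{ (g w, r) : w ∈ N_r(v), r ∈ R }}`. -/
def msgMS [DecidableEq V] (G : KG V R D) (g : V → X) (v : V) : Multiset (X × R) :=
  (G.edges.val.filter (fun e => e.2.2 = v)).map (fun e => (g e.2.1, e.1))

end KG

/-- Color type of the relational local 1-WL test after `t` rounds (τ is the identity pairing). -/
def Color1 (D R : Type) : ℕ → Type
  | 0 => D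
  | t + 1 => Color1 D R t × Multiset (Color1 D R t × R)

/-- The relational local 1-WL test `rwl₁`. -/
def rwl1 {V R D : Type} [DecidableEq V] (G : KG V R D) : (t : ℕ) → V → Color1 D R t
  | 0 => G.color
  | t + 1 => fun v => (rwl1 G t v, G.msgMS (rwl1 G t) v)

/-- The relational asymmetric local 2-WL test `rawl₂` with initial pairwise coloring `η`. -/
def rawl2 {V R D D₂ : Type} [DecidableEq V] (G : KG V R D) (η : V → V → D₂) :
    (t : ℕ) → V → V → Color1 D₂ R t
  | 0 => η
  | t + 1 => fun u v => (rawl2 G η t u v, G.msgMS (rawl2 G η t u) v)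

/-- Color type of the relational symmetric local 2-WL test after `t` rounds. -/
def Color2 (D R : Type) : ℕ → Type
  | 0 => D
  | t + 1 => Color2 D R t × Multiset (Color2 D R t × R) × Multiset (Color2 D R t × R)

/-- The relational symmetric local 2-WL test `rwl₂` with initial pairwise coloring `η`. -/
def rwl2 {V R D D₂ : Type} [DecidableEq V] (G : KG V R D) (η : V → V → D₂) :
    (t : ℕ) → V → V → Color2 D₂ R t
  | 0 => η
  | t + 1 => fun u v =>
      (rwl2 G η t u v, G.msgMS (fun w => rwl2 G η t w v) u, G.msgMS (rwl2 G η t u) v)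

/-- The augmented knowledge graph `G⁺` with fresh inverse relations (`Sum.inr r` is `r⁻`). -/
def KG.aug {V R D : Type} [DecidableEq V] [DecidableEq R] (G : KG V R D) : KG V (R ⊕ R) D where
  edges := G.edges.image (fun e => (Sum.inl e.1, e.2)) ∪
    (G.edges.filter (fun e => e.2.1 ≠ e.2.2)).image (fun e => (Sum.inr e.1, e.2.2, e.2.1))
  color := G.color

/-- The graph `G²` of pairs: facts `r((u,w),(u,v))` for `r(w,v) ∈ E`, colored by `η`. -/
def KG.sq {V R D D₂ : Type} [Fintype V] [DecidableEq V] [DecidableEq R]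
    (G : KG V R D) (η : V → V → D₂) : KG (V × V) R D₂ where
  edges := (Finset.univ ×ˢ G.edges).image
      (fun p => (p.2.1, (p.1, p.2.2.1), (p.1, p.2.2.2)))
  color := fun p => η p.1 p.2

/-- A relational message passing neural network (R-MPNN) with feature dimensions `d t`:
a history function `f` (non-decreasing, `f t ≤ t`) and, per layer, arbitrary
relation-specific message functions, an aggregation on finite multisets and an update. -/
structure RMPNN (R : Type) (d : ℕ → ℕ) where
  f : ℕ → ℕ
  f_mono : Monotone f
  f_le : ∀ t, f t ≤ t
  M : ℕ → Type
  A : ℕ → Type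
  msg : (t : ℕ) → R → (Fin (d t) → ℝ) → M t
  agg : (t : ℕ) → Multiset (M t) → A t
  upd : (t : ℕ) → (Fin (d (f t)) → ℝ) → A t → Fin (d (t + 1)) → ℝ

/-- Features `h^(t)_v` computed by an R-MPNN on `G` from initial features `x`. -/
def RMPNN.h {V R D : Type} [DecidableEq V] {d : ℕ → ℕ} (N : RMPNN R d) (G : KG V R D)
    (x : V → Fin (d 0) → ℝ) : (t : ℕ) → V → Fin (d t) → ℝ
  | 0 => x
  | t + 1 => fun v =>
      N.upd t (N.h G x (N.f t) v)
        (N.agg t ((G.edges.val.filter (fun e => e.2.2 = v)).map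
          (fun e => N.msg t e.1 (N.h G x t e.2.1))))
termination_by t => t
decreasing_by
  · exact Nat.lt_succ_of_le (N.f_le t)
  · exact Nat.lt_succ_self t

/-- A conditional message passing neural network (C-MPNN) with feature dimensions `d t`;
the relation-specific message functions additionally take the query relation. -/
structure CMPNN (R : Type) (d : ℕ → ℕ) where
  f : ℕ → ℕ
  f_mono : Monotone f
  f_le : ∀ t, f t ≤ t
  M : ℕ → Type
  A : ℕ → Type
  msg : (t : ℕ) → R → (Fin (d t) → ℝ) → R → M t
  agg : (t : ℕ) → Multiset (M t) → A t
  upd : (t : ℕ) → (Fin (d (f t)) → ℝ) → A t → Fin (d (t + 1)) → ℝ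

/-- Features `h^(t)_{v|u,q}` computed by a C-MPNN on `G` for query `q` with
initialization `δ`; `CMPNN.h N G q δ t u v = h_q^(t)(u,v)`. -/
def CMPNN.h {V R D : Type} [DecidableEq V] {d : ℕ → ℕ} (N : CMPNN R d) (G : KG V R D)
    (q : R) (δ : V → V → R → Fin (d 0) → ℝ) : (t : ℕ) → V → V → Fin (d t) → ℝ
  | 0 => fun u v => δ u v q
  | t + 1 => fun u v =>
      N.upd t (N.h G q δ (N.f t) u v)
        (N.agg t ((G.edges.val.filter (fun e => e.2.2 = v)).map
          (fun e => N.msg t e.1 (N.h G q δ t u e.2.1) q)))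
termination_by t => t
decreasing_by
  · exact Nat.lt_succ_of_le (N.f_le t)
  · exact Nat.lt_succ_self t

/-- There are a knowledge graph `G` with pairwise coloring `η` and pairs
`(u,v)`, `(u',v')` such that `rwl₂^(t)(G,u,v) = rwl₂^(t)(G,u',v')` for all `t ≥ 0` but
`rwl₂⁺^(1)(G,u,v) ≠ rwl₂⁺^(1)(G,u',v')`. -/
theorem rwl2plus_strictly_finer : ∃ (V R D D₂ : Type) (iV : DecidableEq V)
    (iR : DecidableEq R) (G : KG V R D) (η : V → V → D₂) (u v u' v' : V),
    (∀ t : ℕ, @rwl2 V R D D₂ iV G η t u v = @rwl2 V R D D₂ iV G η t u' v') ∧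
    @rwl2 V (R ⊕ R) D D₂ iV (@KG.aug V R D iV iR G) η 1 u v ≠
      @rwl2 V (R ⊕ R) D D₂ iV (@KG.aug V R D iV iR G) η 1 u' v' := by
  refine ⟨Fin 6, Bool, Unit, Unit, inferInstance, inferInstance,
    ⟨{(true, 0, 4), (false, 1, 5)}, fun _ => ()⟩, fun _ _ => (), 0, 2, 1, 3, ?_, ?_⟩
  · intro t
    induction t with
    | zero => rfl
    | succ t ih =>
      have key : ∀ (X : Type) (g : Fin 6 → X) (a : Fin 6), a < 4 →
          KG.msgMS (⟨{(true, 0, 4), (false, 1, 5)}, fun _ => ()⟩ : KG (Fin 6) Bool Unit) g a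
            = 0 := by
        intro X g a ha
        unfold KG.msgMS
        rw [Multiset.map_eq_zero, Multiset.filter_eq_nil]
        revert a
        decide
      simp only [rwl2]
      rw [key _ _ 0 (by decide), key _ _ 1 (by decide), key _ _ 2 (by decide),
        key _ _ 3 (by decide), ih]
  · intro h
    have h2 : (KG.aug (⟨{(true, 0, 4), (false, 1, 5)}, fun _ => ()⟩ :
        KG (Fin 6) Bool Unit)).msgMS (fun _ => ()) 0 =
        (KG.aug (⟨{(true, 0, 4), (false, 1, 5)}, fun _ => ()⟩ :
        KG (Fin 6) Bool Unit)).msgMS (fun _ => ()) 1 :=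
      congrArg (fun p => p.2.1) h
    revert h2
    decide
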